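/- arXiv:2402.04375 — 4 statements merged into one kernel-verified Lean document; each statement's English description precedes it below -/
import Mathlib

section
/- There exists an absolute constant C > 0 such that the following holds. Let m, n ≥ 1 and d ≥ 2 be integers with d ≤ m+1, let K > 0, ν ≥ 0, and let τ > 0 satisfy τ·√m ≥ 1. Let φ : ℝ → ℝ be continuous and K-Lipschitz, and let D_r and D_s be datasets of size n over m+1 attributes. Let w_r be a minimizer of L(·,D_r) over the ball {w ∈ ℝ^m : ‖w‖₂ ≤ τ} and let w_s be a minimizer of L(·,D_s) over the same ball. If ‖M_q(D_r) − M_q(D_s)‖₁ ≤ ν for every q ∈ Q^m_{≤d}, then |L(w_s,D_r) − L(w_r,D_r)| ≤ C·( K·τ·√(m/(d−1)) + (1/n)·(K·τ·√m + |φ(0)|)·(3m·max{1,τ})^{d−1}·ν ). -/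
noncomputable section
open Finset MeasureTheory ProbabilityTheory Real

def ValidDomains (m : ℕ) (Ω : Fin (m+1) → Finset ℝ) : Prop :=
  (∀ j, (Ω j : Set ℝ) ⊆ Set.Icc (-1 : ℝ) 1) ∧ Ω (Fin.last m) = ({-1, 1} : Finset ℝ)

def ValidDataset {m n : ℕ} (Ω : Fin (m+1) → Finset ℝ) (D : Fin n → Fin (m+1) → ℝ) : Prop :=
  ∀ i j, D i j ∈ Ω j

def marginal {m n : ℕ} (D : Fin n → Fin (m+1) → ℝ) (q : Finset (Fin (m+1)))
    (t : ∀ j ∈ q, ℝ) : ℝ :=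
  Nat.card {i : Fin n // ∀ j (h : j ∈ q), D i j = t j h}

def margL1 {m n : ℕ} (Ω : Fin (m+1) → Finset ℝ) (Dr Ds : Fin n → Fin (m+1) → ℝ)
    (q : Finset (Fin (m+1))) : ℝ :=
  ∑ t ∈ q.pi Ω, |marginal Dr q t - marginal Ds q t|

def margin {m : ℕ} (w : EuclideanSpace ℝ (Fin m)) (v : Fin (m+1) → ℝ) : ℝ :=
  (∑ j : Fin m, w j * v j.castSucc) * v (Fin.last m)

def risk {m n : ℕ} (φ : ℝ → ℝ) (w : EuclideanSpace ℝ (Fin m))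
    (D : Fin n → Fin (m+1) → ℝ) : ℝ :=
  (1 / n) * ∑ i, φ (margin w (D i))

lemma sum_eq_sum_marginal_mul {m n : ℕ} (Ω : Fin (m+1) → Finset ℝ)
    {D : Fin n → Fin (m+1) → ℝ} (hD : ValidDataset Ω D) (q : Finset (Fin (m+1)))
    (g : (∀ j ∈ q, ℝ) → ℝ) :
    ∑ i, g (fun j _ => D i j) = ∑ t ∈ q.pi Ω, marginal D q t * g t := by
  classical
  have hmap : ∀ i ∈ (univ : Finset (Fin n)), (fun j (_ : j ∈ q) => D i j) ∈ q.pi Ω :=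
    fun i _ => Finset.mem_pi.2 fun j _ => hD i j
  rw [← Finset.sum_fiberwise_of_maps_to hmap]
  refine Finset.sum_congr rfl fun t _ => ?_
  have hcard : marginal D q t
      = ((univ.filter fun i => (fun j (_ : j ∈ q) => D i j) = t).card : ℝ) := by
    unfold marginal
    rw [Nat.card_eq_fintype_card, Fintype.card_subtype]
    congr 2
    ext i
    simp [funext_iff]
  rw [hcard, ← nsmul_eq_mul]
  refine Finset.sum_eq_card_nsmul fun i hi => ?_
  rw [(Finset.mem_filter.1 hi).2]

lemma abs_sum_sub_sum_le_margL1 {m n : ℕ} (Ω : Fin (m+1) → Finset ℝ)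
    {Dr Ds : Fin n → Fin (m+1) → ℝ} (hr : ValidDataset Ω Dr) (hs : ValidDataset Ω Ds)
    (q : Finset (Fin (m+1))) (g : (∀ j ∈ q, ℝ) → ℝ) (hg : ∀ t ∈ q.pi Ω, |g t| ≤ 1) :
    |∑ i, g (fun j _ => Dr i j) - ∑ i, g (fun j _ => Ds i j)| ≤ margL1 Ω Dr Ds q := by
  rw [sum_eq_sum_marginal_mul Ω hr, sum_eq_sum_marginal_mul Ω hs, ← Finset.sum_sub_distrib]
  refine (Finset.abs_sum_le_sum_abs _ _).trans (Finset.sum_le_sum fun t ht => ?_)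
  rw [← sub_mul, abs_mul]
  exact mul_le_of_le_one_right (abs_nonneg _) (hg t ht)

/-- The signed feature `x j * y` of a record, with `none` standing for the constant `1`. -/
def signedFeature {m : ℕ} (v : Fin (m+1) → ℝ) : Option (Fin m) → ℝ
  | none => 1
  | some j => v j.castSucc * v (Fin.last m)

lemma abs_signedFeature_le_one {m : ℕ} {v : Fin (m+1) → ℝ} (hv : ∀ j, |v j| ≤ 1)
    (a : Option (Fin m)) : |signedFeature v a| ≤ 1 := by
  cases a with
  | none => simp [signedFeature]
  | some j =>
    simp only [signedFeature, abs_mul]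
    exact mul_le_one₀ (hv _) (abs_nonneg _) (hv _)

lemma ValidDomains.abs_le_one {m : ℕ} {Ω : Fin (m+1) → Finset ℝ} (hΩ : ValidDomains m Ω)
    {j : Fin (m+1)} {x : ℝ} (hx : x ∈ Ω j) : |x| ≤ 1 :=
  abs_le.2 (hΩ.1 j (Finset.mem_coe.2 hx))

lemma abs_sum_prod_signedFeature_sub_le {m n d : ℕ} {ι : Type*} [Fintype ι] {ν : ℝ}
    {Ω : Fin (m+1) → Finset ℝ} (hΩ : ValidDomains m Ω)
    {Dr Ds : Fin n → Fin (m+1) → ℝ} (hr : ValidDataset Ω Dr) (hs : ValidDataset Ω Ds)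
    (hν : ∀ q : Finset (Fin (m+1)), q.Nonempty → q.card ≤ d → margL1 Ω Dr Ds q ≤ ν)
    (hι : Fintype.card ι + 1 ≤ d) (a : ι → Option (Fin m)) :
    |∑ i, ∏ l, signedFeature (Dr i) (a l) - ∑ i, ∏ l, signedFeature (Ds i) (a l)| ≤ ν := by
  classical
  set q : Finset (Fin (m+1)) :=
    insert (Fin.last m) (Finset.univ.image fun l => (a l).elim (Fin.last m) Fin.castSucc) with hq
  have hcard : q.card ≤ d :=
    (Finset.card_insert_le _ _).trans ((Nat.add_le_add_right Finset.card_image_le 1).trans hι)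
  have hlast : Fin.last m ∈ q := Finset.mem_insert_self _ _
  have hmem : ∀ l j, a l = some j → j.castSucc ∈ q := fun l j h =>
    Finset.mem_insert_of_mem (Finset.mem_image.2 ⟨l, Finset.mem_univ _, by simp [h]⟩)
  let ext : (∀ j ∈ q, ℝ) → Fin (m+1) → ℝ := fun t j => if h : j ∈ q then t j h else 0
  have key : ∀ v : Fin (m+1) → ℝ, ∏ l, signedFeature v (a l)
      = ∏ l, signedFeature (ext fun j _ => v j) (a l) := by
    intro v
    refine Finset.prod_congr rfl fun l _ => ?_
    cases h : a l with
    | none => rfl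
    | some j => simp [signedFeature, ext, hlast, hmem l j h]
  rw [Finset.sum_congr rfl fun i _ => key (Dr i), Finset.sum_congr rfl fun i _ => key (Ds i)]
  refine (abs_sum_sub_sum_le_margL1 Ω hr hs q (fun t => ∏ l, signedFeature (ext t) (a l))
    fun t ht => ?_).trans (hν q ⟨_, hlast⟩ hcard)
  rw [Finset.abs_prod]
  refine Finset.prod_le_one (fun _ _ => abs_nonneg _) fun l _ =>
    abs_signedFeature_le_one (fun j => ?_) _
  by_cases h : j ∈ q
  · simpa [ext, h] using hΩ.abs_le_one (Finset.mem_pi.1 ht j h)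
  · simp [ext, h]

/-- Products of few normalized affine functions of the margin have nearly equal sums over
datasets with nearly equal low-order marginals. -/
lemma abs_sum_prod_affine_margin_sub_le {m n d : ℕ} {ι : Type*} [Fintype ι] {ν R : ℝ}
    {Ω : Fin (m+1) → Finset ℝ} (hΩ : ValidDomains m Ω)
    {Dr Ds : Fin n → Fin (m+1) → ℝ} (hr : ValidDataset Ω Dr) (hs : ValidDataset Ω Ds)
    (hν : ∀ q : Finset (Fin (m+1)), q.Nonempty → q.card ≤ d → margL1 Ω Dr Ds q ≤ ν)
    (hν0 : 0 ≤ ν) (hι : Fintype.card ι + 1 ≤ d) (hR : 0 < R)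
    {w : EuclideanSpace ℝ (Fin m)} (hw : ∑ j, |w j| ≤ R) (s : ι → ℝ) (hs1 : ∀ l, |s l| ≤ 1) :
    |∑ i, ∏ l, (1 + s l * (margin w (Dr i) / R)) / 2
      - ∑ i, ∏ l, (1 + s l * (margin w (Ds i) / R)) / 2| ≤ ν := by
  classical
  let α : ι → Option (Fin m) → ℝ := fun l a => a.elim (1 / 2) fun j => s l * w j / (2 * R)
  have expand : ∀ v : Fin (m+1) → ℝ, ∏ l, (1 + s l * (margin w v / R)) / 2
      = ∑ a : ι → Option (Fin m), (∏ l, α l (a l)) * ∏ l, signedFeature v (a l) := by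
    intro v
    simp only [← Finset.prod_mul_distrib]
    rw [← Fintype.prod_sum (fun l b => α l b * signedFeature v b)]
    refine Finset.prod_congr rfl fun l _ => ?_
    rw [Fintype.sum_option]
    simp only [α, signedFeature, margin, Option.elim, Finset.sum_mul, Finset.sum_div,
      Finset.mul_sum, add_div, mul_one]
    congr 1
    refine Finset.sum_congr rfl fun j _ => ?_
    field_simp
  have hα : ∀ l, ∑ a, |α l a| ≤ 1 := by
    intro l
    rw [Fintype.sum_option]
    have h1 : ∑ j, |α l (some j)| ≤ ∑ j, |w j| / (2 * R) := by
      refine Finset.sum_le_sum fun j _ => ?_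
      simp only [α, Option.elim]
      rw [abs_div, abs_mul, abs_of_pos (by positivity : 0 < 2 * R)]
      gcongr
      exact mul_le_of_le_one_left (abs_nonneg _) (hs1 l)
    have h2 : ∑ j, |w j| / (2 * R) ≤ 1 / 2 := by
      rw [← Finset.sum_div, div_le_div_iff₀ (by positivity) (by norm_num)]
      linarith
    have h3 : |α l none| = 1 / 2 := by simp [α]
    linarith
  have split : ∀ D : Fin n → Fin (m+1) → ℝ, ∑ i, ∏ l, (1 + s l * (margin w (D i) / R)) / 2
      = ∑ a : ι → Option (Fin m), (∏ l, α l (a l)) * ∑ i, ∏ l, signedFeature (D i) (a l) := by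
    intro D
    simp only [expand, Finset.mul_sum]
    exact Finset.sum_comm
  rw [split, split, ← Finset.sum_sub_distrib]
  calc _ ≤ ∑ a : ι → Option (Fin m), (∏ l, |α l (a l)|) * ν := by
        refine (Finset.abs_sum_le_sum_abs _ _).trans (Finset.sum_le_sum fun a _ => ?_)
        rw [← mul_sub, abs_mul, Finset.abs_prod]
        exact mul_le_mul_of_nonneg_left
          (abs_sum_prod_signedFeature_sub_le hΩ hr hs hν hι a)
          (Finset.prod_nonneg fun _ _ => abs_nonneg _)
    _ = (∏ l, ∑ a, |α l a|) * ν := by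
        rw [← Finset.sum_mul, Fintype.prod_sum (fun l b => |α l b|)]
    _ ≤ ν := mul_le_of_le_one_left hν0
        (Finset.prod_le_one (fun l _ => Finset.sum_nonneg fun _ _ => abs_nonneg _)
          fun l _ => hα l)

lemma abs_sum_pow_mul_pow_margin_sub_le {m n k i : ℕ} {ν R : ℝ} (hik : i ≤ k)
    {Ω : Fin (m+1) → Finset ℝ} (hΩ : ValidDomains m Ω)
    {Dr Ds : Fin n → Fin (m+1) → ℝ} (hr : ValidDataset Ω Dr) (hs : ValidDataset Ω Ds)
    (hν : ∀ q : Finset (Fin (m+1)), q.Nonempty → q.card ≤ k + 1 → margL1 Ω Dr Ds q ≤ ν)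
    (hν0 : 0 ≤ ν) (hR : 0 < R)
    {w : EuclideanSpace ℝ (Fin m)} (hw : ∑ j, |w j| ≤ R) :
    |∑ a, ((1 + margin w (Dr a) / R) / 2) ^ i * (1 - (1 + margin w (Dr a) / R) / 2) ^ (k - i)
      - ∑ a, ((1 + margin w (Ds a) / R) / 2) ^ i *
        (1 - (1 + margin w (Ds a) / R) / 2) ^ (k - i)| ≤ ν := by
  have h := abs_sum_prod_affine_margin_sub_le (ι := Fin i ⊕ Fin (k - i)) hΩ hr hs hν hν0
    (by simp; omega) hR hw (Sum.elim (fun _ => 1) fun _ => -1) (by rintro (_ | _) <;> simp)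
  have hflip : ∀ u : ℝ, (1 + -1 * u) / 2 = 1 - (1 + u) / 2 := fun u => by ring
  simpa only [Fintype.prod_sum_type, Sum.elim_inl, Sum.elim_inr, one_mul, hflip,
    Finset.prod_const, Finset.card_univ, Fintype.card_fin] using h

/-- Quantitative Bernstein approximation of a Lipschitz function on `[0, 1]`. -/
lemma abs_sub_bernstein_sum_le {k : ℕ} (hk : 0 < k) {ψ : ℝ → ℝ} {L : ℝ}
    (hψ : ∀ x y, |ψ x - ψ y| ≤ L * |x - y|) {x : ℝ} (hx0 : 0 ≤ x) (hx1 : x ≤ 1) :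
    |ψ x - ∑ i ∈ Finset.range (k + 1),
      ψ (i / k) * (k.choose i * (x ^ i * (1 - x) ^ (k - i)))| ≤ L / √k := by
  have hL : 0 ≤ L := by simpa using (abs_nonneg _).trans (hψ 1 0)
  have hk' : (0 : ℝ) < k := by exact_mod_cast hk
  have hsk : 0 < √(k : ℝ) := Real.sqrt_pos.2 hk'
  set b : ℕ → ℝ := fun i => k.choose i * (x ^ i * (1 - x) ^ (k - i)) with hb
  have hb0 : ∀ i, 0 ≤ b i := fun i => by
    have := sub_nonneg.2 hx1
    positivity
  have hev : ∀ i, (bernsteinPolynomial ℝ k i).eval x = b i := fun i => by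
    simp [bernsteinPolynomial, hb, mul_assoc]
  have hsum : ∑ i ∈ Finset.range (k + 1), b i = 1 := by
    have := congrArg (Polynomial.eval x) (bernsteinPolynomial.sum ℝ k)
    simpa [Polynomial.eval_finsetSum, hev] using this
  have hvar : ∑ i ∈ Finset.range (k + 1), (k * x - i) ^ 2 * b i = k * x * (1 - x) := by
    have := congrArg (Polynomial.eval x) (bernsteinPolynomial.variance ℝ k)
    simpa [Polynomial.eval_finsetSum, hev] using this
  have hdev : ∀ i : ℕ, |x - i / k| ≤ ((k * x - i) ^ 2 / k + 1) / (2 * √k) := by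
    intro i
    rw [le_div_iff₀ (by positivity)]
    have h1 : (k * x - i) ^ 2 / k = (√k * |x - i / k|) ^ 2 := by
      rw [mul_pow, sq_abs, Real.sq_sqrt hk'.le]
      field_simp
    rw [h1]
    nlinarith [sq_nonneg (√k * |x - i / k| - 1)]
  have hψx : ψ x = ∑ i ∈ Finset.range (k + 1), ψ x * b i := by
    rw [← Finset.mul_sum, hsum, mul_one]
  rw [hψx, ← Finset.sum_sub_distrib]
  calc _ ≤ ∑ i ∈ Finset.range (k + 1),
          L * (((k * x - i) ^ 2 / k + 1) / (2 * √k)) * b i := by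
        refine (Finset.abs_sum_le_sum_abs _ _).trans (Finset.sum_le_sum fun i _ => ?_)
        rw [← sub_mul, abs_mul, abs_of_nonneg (hb0 i)]
        exact mul_le_mul_of_nonneg_right
          ((hψ _ _).trans (mul_le_mul_of_nonneg_left (hdev i) hL)) (hb0 i)
    _ = L / (2 * √k) * ((∑ i ∈ Finset.range (k + 1), (k * x - i) ^ 2 * b i) / k
          + ∑ i ∈ Finset.range (k + 1), b i) := by
        rw [Finset.sum_div, ← Finset.sum_add_distrib, Finset.mul_sum]
        refine Finset.sum_congr rfl fun i _ => ?_
        ring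
    _ = L / (2 * √k) * (x * (1 - x) + 1) := by
        rw [hvar, hsum]
        field_simp
    _ ≤ L / (2 * √k) * 2 := by
        gcongr
        nlinarith
    _ = L / √k := by
        field_simp

lemma sum_abs_le_mul_sqrt {m : ℕ} {w : EuclideanSpace ℝ (Fin m)} {τ : ℝ} (hw : ‖w‖ ≤ τ) :
    ∑ j, |w j| ≤ τ * √m := by
  refine le_trans ?_ (mul_le_mul_of_nonneg_right hw (Real.sqrt_nonneg _))
  rw [EuclideanSpace.norm_eq, ← Real.sqrt_mul (Finset.sum_nonneg fun _ _ => sq_nonneg _)]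
  refine Real.le_sqrt_of_sq_le ?_
  have := sq_sum_le_card_mul_sum_sq (s := Finset.univ) (f := fun j => |w j|)
  simpa [mul_comm] using this

lemma abs_margin_le {m : ℕ} {w : EuclideanSpace ℝ (Fin m)} {v : Fin (m+1) → ℝ} {R : ℝ}
    (hw : ∑ j, |w j| ≤ R) (hv : ∀ j, |v j| ≤ 1) : |margin w v| ≤ R := by
  unfold margin
  rw [abs_mul]
  refine (mul_le_of_le_one_right (abs_nonneg _) (hv _)).trans
    ((Finset.abs_sum_le_sum_abs _ _).trans ((Finset.sum_le_sum fun j _ => ?_).trans hw))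
  rw [abs_mul]
  exact mul_le_of_le_one_right (abs_nonneg _) (hv _)

lemma abs_risk_sub_risk_le {m n k : ℕ} (hn : 0 < n) (hk : 0 < k) {K ν R : ℝ} (hK : 0 ≤ K)
    (hν0 : 0 ≤ ν) (hR : 0 < R)
    {Ω : Fin (m+1) → Finset ℝ} (hΩ : ValidDomains m Ω)
    {Dr Ds : Fin n → Fin (m+1) → ℝ} (hr : ValidDataset Ω Dr) (hs : ValidDataset Ω Ds)
    (hν : ∀ q : Finset (Fin (m+1)), q.Nonempty → q.card ≤ k + 1 → margL1 Ω Dr Ds q ≤ ν)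
    {φ : ℝ → ℝ} (hφ : ∀ x y, |φ x - φ y| ≤ K * |x - y|)
    {w : EuclideanSpace ℝ (Fin m)} (hw : ∑ j, |w j| ≤ R) :
    |risk φ w Dr - risk φ w Ds|
      ≤ 4 * (K * R / √k) + (1 / n) * (K * R + |φ 0|) * 2 ^ k * ν := by
  have hn' : (0 : ℝ) < n := by exact_mod_cast hn
  have hk' : (0 : ℝ) < k := by exact_mod_cast hk
  let ψ : ℝ → ℝ := fun x => φ (R * (2 * x - 1))
  let X : (Fin (m+1) → ℝ) → ℝ := fun v => (1 + margin w v / R) / 2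
  let P : (Fin (m+1) → ℝ) → ℝ := fun v => ∑ i ∈ Finset.range (k + 1),
      ψ (i / k) * (k.choose i * (X v ^ i * (1 - X v) ^ (k - i)))
  have hψ : ∀ x y, |ψ x - ψ y| ≤ (2 * K * R) * |x - y| := by
    intro x y
    refine (hφ _ _).trans (le_of_eq ?_)
    rw [show R * (2 * x - 1) - R * (2 * y - 1) = 2 * R * (x - y) by ring, abs_mul,
      abs_of_pos (by positivity : 0 < 2 * R)]
    ring
  have hψX : ∀ v, ψ (X v) = φ (margin w v) := by
    intro v
    simp only [ψ, X]
    congr 1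
    field_simp
    ring
  have happrox : ∀ D : Fin n → Fin (m+1) → ℝ, ValidDataset Ω D →
      |∑ a, φ (margin w (D a)) - ∑ a, P (D a)| ≤ n * (2 * K * R / √k) := by
    intro D hD
    rw [← Finset.sum_sub_distrib]
    refine (Finset.abs_sum_le_sum_abs _ _).trans ((Finset.sum_le_card_nsmul _ _
      (2 * K * R / √k) fun a _ => ?_).trans (by simp))
    have hmar := abs_le.1 (abs_margin_le hw fun j => hΩ.abs_le_one (hD a j))
    have h1 : -1 ≤ margin w (D a) / R := by rw [le_div_iff₀ hR]; linarith
    have h2 : margin w (D a) / R ≤ 1 := by rw [div_le_iff₀ hR]; linarith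
    rw [← hψX]
    exact abs_sub_bernstein_sum_le hk hψ (by simp only [X]; linarith) (by simp only [X]; linarith)
  have hψb : ∀ i ∈ Finset.range (k + 1), |ψ (i / k)| ≤ K * R + |φ 0| := by
    intro i hi
    have hi' : (i : ℝ) ≤ k := by exact_mod_cast Nat.lt_succ_iff.1 (Finset.mem_range.1 hi)
    have h0 : 0 ≤ (i : ℝ) / k := by positivity
    have h1 : (i : ℝ) / k ≤ 1 := (div_le_one hk').2 hi'
    have h2 : |R * (2 * ((i : ℝ) / k) - 1)| ≤ R := by
      rw [abs_mul, abs_of_pos hR]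
      exact mul_le_of_le_one_right hR.le (abs_le.2 ⟨by linarith, by linarith⟩)
    have h3 := hφ (R * (2 * ((i : ℝ) / k) - 1)) 0
    rw [sub_zero] at h3
    have h4 := abs_sub_abs_le_abs_sub (φ (R * (2 * ((i : ℝ) / k) - 1))) (φ 0)
    have h5 := mul_le_mul_of_nonneg_left h2 hK
    simp only [ψ]
    linarith
  have hPsum : ∀ D : Fin n → Fin (m+1) → ℝ, ∑ a, P (D a)
      = ∑ i ∈ Finset.range (k + 1),
        ψ (i / k) * (k.choose i * ∑ a, X (D a) ^ i * (1 - X (D a)) ^ (k - i)) := by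
    intro D
    simp only [P, Finset.mul_sum]
    exact Finset.sum_comm
  have hP : |∑ a, P (Dr a) - ∑ a, P (Ds a)| ≤ (K * R + |φ 0|) * 2 ^ k * ν := by
    rw [hPsum, hPsum, ← Finset.sum_sub_distrib]
    calc _ ≤ ∑ i ∈ Finset.range (k + 1), (K * R + |φ 0|) * (k.choose i * ν) := by
          refine (Finset.abs_sum_le_sum_abs _ _).trans (Finset.sum_le_sum fun i hi => ?_)
          rw [← mul_sub, ← mul_sub, abs_mul, abs_mul, Nat.abs_cast]
          refine mul_le_mul (hψb i hi) (mul_le_mul_of_nonneg_left ?_ (Nat.cast_nonneg _))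
            (by positivity) (by positivity)
          exact abs_sum_pow_mul_pow_margin_sub_le (Nat.lt_succ_iff.1 (Finset.mem_range.1 hi))
            hΩ hr hs hν hν0 hR hw
      _ = (K * R + |φ 0|) * 2 ^ k * ν := by
          rw [← Finset.mul_sum, ← Finset.sum_mul, mul_assoc]
          congr 2
          exact_mod_cast Nat.sum_range_choose k
  have hA := abs_le.1 (happrox Dr hr)
  have hB := abs_le.1 (happrox Ds hs)
  have hC := abs_le.1 hP
  have htot : |∑ a, φ (margin w (Dr a)) - ∑ a, φ (margin w (Ds a))|
      ≤ n * (4 * (K * R / √k)) + (K * R + |φ 0|) * 2 ^ k * ν := by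
    have : n * (4 * (K * R / √k)) = n * (2 * K * R / √k) + n * (2 * K * R / √k) := by ring
    rw [this]
    exact abs_le.2 ⟨by linarith [hA.1, hB.2, hC.1], by linarith [hA.2, hB.1, hC.2]⟩
  unfold risk
  rw [← mul_sub, abs_mul, abs_of_pos (by positivity : (0 : ℝ) < 1 / n)]
  refine (mul_le_mul_of_nonneg_left htot (by positivity)).trans (le_of_eq ?_)
  field_simp

/-- excess empirical risk bound for linear models trained on
marginal-preserving synthetic data, for continuous Lipschitz losses. -/
theorem excess_risk_upper_bound_lipschitz :
    ∃ C : ℝ, 0 < C ∧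
      ∀ (m n d : ℕ), 1 ≤ m → 1 ≤ n → 2 ≤ d → d ≤ m + 1 →
      ∀ (K ν τ : ℝ), 0 < K → 0 ≤ ν → 0 < τ → 1 ≤ τ * Real.sqrt m →
      ∀ (Ω : Fin (m+1) → Finset ℝ), ValidDomains m Ω →
      ∀ (Dr Ds : Fin n → Fin (m+1) → ℝ), ValidDataset Ω Dr → ValidDataset Ω Ds →
      ∀ (φ : ℝ → ℝ), Continuous φ → LipschitzWith (Real.toNNReal K) φ →
      ∀ (wr ws : EuclideanSpace ℝ (Fin m)),
        ‖wr‖ ≤ τ → (∀ w : EuclideanSpace ℝ (Fin m), ‖w‖ ≤ τ → risk φ wr Dr ≤ risk φ w Dr) →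
        ‖ws‖ ≤ τ → (∀ w : EuclideanSpace ℝ (Fin m), ‖w‖ ≤ τ → risk φ ws Ds ≤ risk φ w Ds) →
      (∀ q : Finset (Fin (m+1)), q.Nonempty → q.card ≤ d → margL1 Ω Dr Ds q ≤ ν) →
      |risk φ ws Dr - risk φ wr Dr| ≤
        C * (K * τ * Real.sqrt ((m : ℝ) / ((d : ℝ) - 1)) +
          (1 / (n : ℝ)) * (K * τ * Real.sqrt (m : ℝ) + |φ 0|) *
            (3 * (m : ℝ) * max 1 τ) ^ (d - 1) * ν) := by
  refine ⟨8, by norm_num, ?_⟩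
  intro m n d hm hn hd _ K ν τ hK hν0 hτ hτm Ω hΩ Dr Ds hr hs φ _ hlip wr ws hwr hoptr hws hopts hν
  obtain ⟨k, rfl⟩ : ∃ k, d = k + 1 := ⟨d - 1, by omega⟩
  have hk : 0 < k := by omega
  have hR : 0 < τ * √m := by linarith
  have hφ : ∀ x y, |φ x - φ y| ≤ K * |x - y| := by
    intro x y
    simpa [Real.dist_eq, Real.coe_toNNReal K hK.le] using hlip.dist_le_mul x y
  have hboundr := abs_le.1 (abs_risk_sub_risk_le hn hk hK.le hν0 hR hΩ hr hs hν hφ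
    (sum_abs_le_mul_sqrt hwr))
  have hbounds := abs_le.1 (abs_risk_sub_risk_le hn hk hK.le hν0 hR hΩ hr hs hν hφ
    (sum_abs_le_mul_sqrt hws))
  have hpow : (2 : ℝ) ^ k ≤ (3 * (m : ℝ) * max 1 τ) ^ k := by
    have hm' : (1 : ℝ) ≤ m := by exact_mod_cast hm
    have hmax : (1 : ℝ) ≤ max 1 τ := le_max_left _ _
    exact pow_le_pow_left₀ (by norm_num) (by nlinarith) k
  have hterm : (1 / (n : ℝ)) * (K * (τ * √m) + |φ 0|) * 2 ^ k * ν
      ≤ (1 / (n : ℝ)) * (K * (τ * √m) + |φ 0|) * (3 * (m : ℝ) * max 1 τ) ^ k * ν := by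
    gcongr
  have hterm0 : 0 ≤ (1 / (n : ℝ)) * (K * (τ * √m) + |φ 0|) * 2 ^ k * ν := by positivity
  have hsqrt : K * τ * √((m : ℝ) / (((k + 1 : ℕ) : ℝ) - 1)) = K * (τ * √m) / √k := by
    rw [Nat.cast_add, Nat.cast_one, add_sub_cancel_right, Real.sqrt_div (Nat.cast_nonneg _)]
    ring
  rw [hsqrt, Nat.add_sub_cancel, mul_assoc K τ]
  rw [abs_of_nonneg (sub_nonneg.2 (hoptr ws hws))]
  linarith [hopts wr hwr, hbounds.2, hboundr.1]
end
end

section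
/- Let W be a nonempty set, let F_r, F_s, G_r, G_s : W → ℝ, and let ε_P, ε_M ≥ 0. Assume: (i) |G_r(w) − F_r(w)| ≤ ε_P and |G_s(w) − F_s(w)| ≤ ε_P for all w ∈ W; (ii) |G_r(w) − G_s(w)| ≤ ε_M for all w ∈ W; (iii) w_r ∈ W satisfies F_r(w_r) ≤ F_r(w) for all w ∈ W, and w_s ∈ W satisfies F_s(w_s) ≤ F_s(w) for all w ∈ W. Then 0 ≤ F_r(w_s) − F_r(w_r) ≤ 4·ε_P + 2·ε_M. -/
/-- abstract core of the excess-risk upper bound. -/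
theorem abstract_excess_risk {W : Type*} [Nonempty W]
    (Fr Fs Gr Gs : W → ℝ) (εP εM : ℝ) (hεP : 0 ≤ εP) (hεM : 0 ≤ εM)
    (hGr : ∀ w : W, |Gr w - Fr w| ≤ εP) (hGs : ∀ w : W, |Gs w - Fs w| ≤ εP)
    (hM : ∀ w : W, |Gr w - Gs w| ≤ εM)
    (wr ws : W)
    (hwr : ∀ w : W, Fr wr ≤ Fr w) (hws : ∀ w : W, Fs ws ≤ Fs w) :
    0 ≤ Fr ws - Fr wr ∧ Fr ws - Fr wr ≤ 4 * εP + 2 * εM := by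
  have gap (w : W) : |Fr w - Fs w| ≤ 2 * εP + εM := by
    have h₁ := abs_le.mp (hGr w)
    have h₂ := abs_le.mp (hGs w)
    have h₃ := abs_le.mp (hM w)
    rw [abs_le]
    constructor <;> linarith
  have h₁ := abs_le.mp (gap ws)
  have h₂ := abs_le.mp (gap wr)
  exact ⟨sub_nonneg.mpr (hwr ws), by linarith [hws wr]⟩
end

section
/- Let m, n ≥ 1 and 1 ≤ d ≤ m+1 be integers, let D be a dataset of size n over m+1 attributes, let w ∈ ℝ^m, and let P(z) = Σ_{k=0}^{d−1} a_k z^k be a real polynomial of degree at most d−1. Then (1/n)·Σ_{(x,y)∈D} P(⟨w,x⟩·y) = (1/n)·Σ_{k=0}^{d−1} a_k·Σ_{u∈{1,…,m}^k} Σ_{t∈Ω_q} M_q(D)[t]·∏_{i=1}^{k} ( w[u_i]·t[u_i]·t[m+1] ), where for each tuple u = (u_1,…,u_k), q = S(u) ∪ {m+1} with S(u) the set of coordinates appearing in u, t[j] denotes the coordinate of t ∈ Ω_q indexed by j ∈ q, and the empty product (k = 0) equals 1. In particular, the empirical average over D of any polynomial of degree at most d−1 evaluated at ⟨w,x⟩·y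 is determined by the marginals {M_q(D)}_{q∈Q^m_{≤d}}. -/
noncomputable section
open Finset MeasureTheory ProbabilityTheory Real

/-- The attribute set `S(u) ∪ {m+1}` determined by a tuple `u ∈ [m]^k`. -/
def qset {m k : ℕ} (u : Fin k → Fin m) : Finset (Fin (m+1)) :=
  (Finset.univ.image fun i => Fin.castSucc (u i)) ∪ {Fin.last m}

theorem mem_qset_castSucc {m k : ℕ} (u : Fin k → Fin m) (i : Fin k) :
    Fin.castSucc (u i) ∈ qset u :=
  Finset.mem_union_left _ (Finset.mem_image_of_mem _ (Finset.mem_univ i))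

theorem mem_qset_last {m k : ℕ} (u : Fin k → Fin m) :
    Fin.last m ∈ qset u :=
  Finset.mem_union_right _ (Finset.mem_singleton_self _)

open Classical in
theorem marginal_eq_sum_ite {m n : ℕ} (D : Fin n → Fin (m+1) → ℝ) (q : Finset (Fin (m+1)))
    (t : ∀ j ∈ q, ℝ) :
    marginal D q t = ∑ i, if (fun j (_ : j ∈ q) => D i j) = t then (1 : ℝ) else 0 := by
  simp only [marginal, Nat.card_eq_fintype_card, Fintype.card_subtype, Finset.sum_boole,
    funext_iff]

/-- Summing a function against a marginal amounts to summing it over the records. -/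
theorem sum_marginal_mul {m n : ℕ} {Ω : Fin (m+1) → Finset ℝ} {D : Fin n → Fin (m+1) → ℝ}
    (hD : ValidDataset Ω D) (q : Finset (Fin (m+1))) (f : (∀ j ∈ q, ℝ) → ℝ) :
    ∑ t ∈ q.pi Ω, marginal D q t * f t = ∑ i, f fun j _ => D i j := by
  classical
  simp only [marginal_eq_sum_ite, Finset.sum_mul, ite_mul, one_mul, zero_mul]
  rw [Finset.sum_comm]
  refine Finset.sum_congr rfl fun i _ => ?_
  rw [Finset.sum_ite_eq, if_pos (Finset.mem_pi.2 fun j _ => hD i j)]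

theorem margin_pow {m : ℕ} (w : EuclideanSpace ℝ (Fin m)) (v : Fin (m+1) → ℝ) (k : ℕ) :
    margin w v ^ k =
      ∑ u : Fin k → Fin m, ∏ i, (w (u i) * v (Fin.castSucc (u i)) * v (Fin.last m)) := by
  rw [margin, Finset.sum_mul, Fintype.sum_pow]

/-- the empirical average of a polynomial of `⟨w,x⟩·y` of degree
at most `d-1` is determined by the marginals of order at most `d`. -/
theorem poly_risk_from_marginals
    (m n d : ℕ) (hm : 1 ≤ m) (hn : 1 ≤ n) (hd1 : 1 ≤ d) (hd2 : d ≤ m + 1)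
    (a : ℕ → ℝ)
    (Ω : Fin (m+1) → Finset ℝ) (hΩ : ValidDomains m Ω)
    (D : Fin n → Fin (m+1) → ℝ) (hD : ValidDataset Ω D)
    (w : EuclideanSpace ℝ (Fin m)) :
    (1 / (n : ℝ)) * ∑ i : Fin n, (∑ k ∈ Finset.range d, a k * (margin w (D i)) ^ k) =
      (1 / (n : ℝ)) * ∑ k ∈ Finset.range d, a k *
        ∑ u : Fin k → Fin m, ∑ t ∈ (qset u).pi Ω,
          marginal D (qset u) t *
            ∏ i : Fin k,
              (w (u i) * t (Fin.castSucc (u i)) (mem_qset_castSucc u i) *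
                t (Fin.last m) (mem_qset_last u)) := by
  congr 1
  rw [Finset.sum_comm]
  refine Finset.sum_congr rfl fun k _ => ?_
  rw [← Finset.mul_sum]
  congr 1
  simp only [margin_pow]
  rw [Finset.sum_comm]
  exact Finset.sum_congr rfl fun u _ => (sum_marginal_mul hD (qset u) fun t =>
    ∏ i, (w (u i) * t _ (mem_qset_castSucc u i) * t _ (mem_qset_last u))).symm
end
end

section
/- Let m, n ≥ 1 and 1 ≤ d ≤ m+1 be integers with |Q^m_{≤d}| ≤ m^d, let l = max_{1≤j≤m+1} |Ω_j|, and let σ > 0, λ > 0. Let D_r be a dataset of size n over m+1 attributes, let {Z_q[t]} be independent N(0,σ²) random variables indexed by q ∈ Q^m_{≤d} and t ∈ Ω_q, and set ĥ_q = M_q(D_r) + Z_q. Let D_s be any dataset of size n over the same domains such that max_{q∈Q^m_{≤d}} ‖ĥ_q − M_q(D_s)‖₁ ≤ max_{q∈Q^m_{≤d}} ‖ĥ_q − M_q(D)‖₁ for every dataset D of size n over the same domains. Then with probability at least 1 − 2^{−λ} over the noise, for every q ∈ Q^m_{≤d}: ‖M_q(D_r) − M_q(D_s)‖₁ ≤ 2·l^d·√(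 2·( ln(2)·(1+λ) + d·ln(m·l) ) )·σ. -/
noncomputable section
open Finset MeasureTheory ProbabilityTheory Real

def MargIdx (m d : ℕ) (Ω : Fin (m+1) → Finset ℝ) : Type :=
  Σ q : {q : Finset (Fin (m+1)) // q.Nonempty ∧ q.card ≤ d},
    {t : ∀ j ∈ (q : Finset (Fin (m+1))), ℝ // t ∈ (q : Finset (Fin (m+1))).pi Ω}

instance (m d : ℕ) (Ω : Fin (m+1) → Finset ℝ) : Fintype (MargIdx m d Ω) := by
  unfold MargIdx; infer_instance

def noiseMeasure (m d : ℕ) (Ω : Fin (m+1) → Finset ℝ) (σ : ℝ) :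
    Measure (MargIdx m d Ω → ℝ) :=
  Measure.pi fun _ => gaussianReal 0 (Real.toNNReal (σ ^ 2))

/-- `max_{q ∈ Q^m_{≤d}} ‖h_q − M_q(D)‖₁` for a vector `h` of (noisy) marginals. -/
def maxDistToMarginals {m n d : ℕ} (Ω : Fin (m+1) → Finset ℝ)
    (h : MargIdx m d Ω → ℝ) (D : Fin n → Fin (m+1) → ℝ) : ℝ :=
  sSup {r : ℝ | ∃ q : {q : Finset (Fin (m+1)) // q.Nonempty ∧ q.card ≤ d},
    r = ∑ t ∈ ((q : Finset (Fin (m+1))).pi Ω).attach,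
      |h ⟨q, t⟩ - marginal D (q : Finset (Fin (m+1))) t.1|}

theorem hasSubgaussianMGF_id_gaussianReal (v : NNReal) :
    HasSubgaussianMGF id v (gaussianReal 0 v) where
  integrable_exp_mul t := integrable_exp_mul_gaussianReal t
  mgf_le t := by simp [mgf_id_gaussianReal]

theorem measureReal_le_abs_gaussianReal (v : NNReal) {ε : ℝ} (hε : 0 ≤ ε) :
    (gaussianReal 0 v).real {x | ε ≤ |x|} ≤ 2 * Real.exp (-ε ^ 2 / (2 * v)) := by
  have hset : {x : ℝ | ε ≤ |x|} = {x | ε ≤ id x} ∪ {x | ε ≤ (-id) x} := by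
    ext x
    simp [le_abs]
  have h := hasSubgaussianMGF_id_gaussianReal v
  rw [hset, two_mul]
  exact (measureReal_union_le _ _).trans
    (add_le_add (h.measure_ge_le hε) (h.neg.measure_ge_le hε))

theorem measureReal_pi_exists_le_abs_gaussianReal {ι : Type*} [Fintype ι] (v : NNReal)
    {ε : ℝ} (hε : 0 ≤ ε) :
    (Measure.pi fun _ : ι => gaussianReal 0 v).real {z | ∃ i, ε ≤ |z i|} ≤
      Fintype.card ι * (2 * Real.exp (-ε ^ 2 / (2 * v))) := by
  have hset : {z : ι → ℝ | ∃ i, ε ≤ |z i|} = ⋃ i, Function.eval i ⁻¹' {x : ℝ | ε ≤ |x|} := by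
    ext z
    simp
  have hcoord (i : ι) : (Measure.pi fun _ : ι => gaussianReal 0 v).real
      (Function.eval i ⁻¹' {x : ℝ | ε ≤ |x|}) ≤ 2 * Real.exp (-ε ^ 2 / (2 * v)) := by
    rw [(measurePreserving_eval (fun _ : ι => gaussianReal 0 v) i).measureReal_preimage
      (by measurability : MeasurableSet {x : ℝ | ε ≤ |x|}).nullMeasurableSet]
    exact measureReal_le_abs_gaussianReal v hε
  rw [hset]
  refine (measureReal_iUnion_fintype_le _).trans ((Finset.sum_le_sum fun i _ => hcoord i).trans ?_)
  simp

theorem card_pi_le_pow {α : Type*} [DecidableEq α] {β : α → Type*} (s : Finset α)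
    (Ω : ∀ a, Finset (β a)) {l d : ℕ} (hl : 1 ≤ l) (hΩ : ∀ a, (Ω a).card ≤ l)
    (hs : s.card ≤ d) : (s.pi Ω).card ≤ l ^ d := by
  rw [Finset.card_pi]
  exact (Finset.prod_le_pow_card s _ l fun a _ => hΩ a).trans (Nat.pow_le_pow_right hl hs)

theorem card_margIdx_le {m d l : ℕ} (Ω : Fin (m+1) → Finset ℝ) (hl : 1 ≤ l)
    (hΩ : ∀ j, (Ω j).card ≤ l) :
    Fintype.card (MargIdx m d Ω) ≤
      Fintype.card {q : Finset (Fin (m+1)) // q.Nonempty ∧ q.card ≤ d} * l ^ d := by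
  have h : Fintype.card (MargIdx m d Ω) =
      ∑ q : {q : Finset (Fin (m+1)) // q.Nonempty ∧ q.card ≤ d},
        ((q : Finset (Fin (m+1))).pi Ω).card := by
    refine (Fintype.card_congr (Equiv.refl _)).trans (Fintype.card_sigma.trans ?_)
    simp
  rw [h]
  refine (Finset.sum_le_card_nsmul _ _ (l ^ d) fun q _ =>
    card_pi_le_pow q.1 Ω hl hΩ q.2.2).trans_eq ?_
  simp

theorem le_maxDistToMarginals {m n d : ℕ} (Ω : Fin (m+1) → Finset ℝ)
    (h : MargIdx m d Ω → ℝ) (D : Fin n → Fin (m+1) → ℝ)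
    (q : {q : Finset (Fin (m+1)) // q.Nonempty ∧ q.card ≤ d}) :
    ∑ t ∈ ((q : Finset (Fin (m+1))).pi Ω).attach,
      |h ⟨q, t⟩ - marginal D (q : Finset (Fin (m+1))) t.1| ≤ maxDistToMarginals Ω h D := by
  refine le_csSup (Set.Finite.bddAbove ?_) ⟨q, rfl⟩
  refine (Set.finite_range fun q : {q : Finset (Fin (m+1)) // q.Nonempty ∧ q.card ≤ d} =>
    ∑ t ∈ ((q : Finset (Fin (m+1))).pi Ω).attach,
      |h ⟨q, t⟩ - marginal D (q : Finset (Fin (m+1))) t.1|).subset ?_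
  rintro r ⟨q, rfl⟩
  exact ⟨q, rfl⟩

theorem sum_abs_noise_le {m d l : ℕ} {Ω : Fin (m+1) → Finset ℝ} (hl : 1 ≤ l)
    (hΩ : ∀ j, (Ω j).card ≤ l) {z : MargIdx m d Ω → ℝ} {τ : ℝ} (hτ : 0 ≤ τ)
    (hz : ∀ p, |z p| ≤ τ) (q : {q : Finset (Fin (m+1)) // q.Nonempty ∧ q.card ≤ d}) :
    ∑ t ∈ ((q : Finset (Fin (m+1))).pi Ω).attach, |z ⟨q, t⟩| ≤ (l : ℝ) ^ d * τ := by
  refine (Finset.sum_le_card_nsmul _ _ τ fun t _ => hz _).trans ?_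
  rw [nsmul_eq_mul, Finset.card_attach]
  refine mul_le_mul_of_nonneg_right ?_ hτ
  exact_mod_cast card_pi_le_pow q.1 Ω hl hΩ q.2.2

theorem margL1_le_of_noise_le {m n d l : ℕ} {Ω : Fin (m+1) → Finset ℝ} (hl : 1 ≤ l)
    (hΩ : ∀ j, (Ω j).card ≤ l) {z : MargIdx m d Ω → ℝ} {τ : ℝ} (hτ : 0 ≤ τ)
    (hz : ∀ p, |z p| ≤ τ) {Dr Ds : Fin n → Fin (m+1) → ℝ}
    (hle : maxDistToMarginals Ω
        (fun p => marginal Dr (p.1 : Finset (Fin (m+1))) p.2.1 + z p) Ds ≤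
      maxDistToMarginals Ω
        (fun p => marginal Dr (p.1 : Finset (Fin (m+1))) p.2.1 + z p) Dr)
    (q : {q : Finset (Fin (m+1)) // q.Nonempty ∧ q.card ≤ d}) :
    margL1 Ω Dr Ds q ≤ 2 * (l : ℝ) ^ d * τ := by
  have hDr : maxDistToMarginals Ω
      (fun p => marginal Dr (p.1 : Finset (Fin (m+1))) p.2.1 + z p) Dr ≤ (l : ℝ) ^ d * τ := by
    refine csSup_le ⟨_, q, rfl⟩ ?_
    rintro r ⟨q', rfl⟩
    simpa using sum_abs_noise_le hl hΩ hτ hz q'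
  have hDs := (le_maxDistToMarginals Ω _ Ds q).trans (hle.trans hDr)
  have hnoise := sum_abs_noise_le hl hΩ hτ hz q
  rw [margL1, ← Finset.sum_attach]
  calc _ ≤ ∑ t ∈ ((q : Finset (Fin (m+1))).pi Ω).attach,
        (|marginal Dr (q : Finset (Fin (m+1))) t.1 + z ⟨q, t⟩ -
          marginal Ds (q : Finset (Fin (m+1))) t.1| + |z ⟨q, t⟩|) :=
        Finset.sum_le_sum fun t _ => by
          refine (congrArg abs ?_).trans_le (abs_sub _ _)
          ring
    _ ≤ (l : ℝ) ^ d * τ + (l : ℝ) ^ d * τ := by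
        rw [Finset.sum_add_distrib]
        exact add_le_add hDs hnoise
    _ = 2 * (l : ℝ) ^ d * τ := by ring

theorem exp_neg_sq_sqrt_div {k σ lam : ℝ} (d : ℕ) (hk : 1 ≤ k) (hσ : 0 < σ)
    (hlam : 0 < lam) :
    Real.exp (-(Real.sqrt (2 * (Real.log 2 * (1 + lam) + (d : ℝ) * Real.log k)) * σ) ^ 2 /
      (2 * σ ^ 2)) = (2 : ℝ) ^ (-(1 + lam)) * (k ^ d)⁻¹ := by
  have hlog : 0 ≤ Real.log k := Real.log_nonneg hk
  have hlog2 : 0 < Real.log 2 := Real.log_pos one_lt_two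
  rw [mul_pow, Real.sq_sqrt (by positivity), Real.rpow_def_of_pos two_pos,
    ← Real.exp_log (by positivity : (0 : ℝ) < (k ^ d)⁻¹), ← Real.exp_add, Real.log_inv,
    Real.log_pow]
  congr 1
  field_simp
  ring

/-- marginal preservation of the brute-force synthetic dataset. -/
theorem synthetic_data_marginal_preservation
    (m n d : ℕ) (hm : 1 ≤ m) (hn : 1 ≤ n) (hd1 : 1 ≤ d) (hd2 : d ≤ m + 1)
    (hQ : Fintype.card {q : Finset (Fin (m+1)) // q.Nonempty ∧ q.card ≤ d} ≤ m ^ d)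
    (Ω : Fin (m+1) → Finset ℝ) (hΩ : ValidDomains m Ω)
    (l : ℕ) (hl : l = Finset.univ.sup fun j : Fin (m+1) => (Ω j).card)
    (σ lam : ℝ) (hσ : 0 < σ) (hlam : 0 < lam)
    (Dr : Fin n → Fin (m+1) → ℝ) (hDr : ValidDataset Ω Dr) :
    noiseMeasure m d Ω σ
        {z : MargIdx m d Ω → ℝ |
          ∀ Ds : Fin n → Fin (m+1) → ℝ, ValidDataset Ω Ds →
            (∀ D : Fin n → Fin (m+1) → ℝ, ValidDataset Ω D →
              maxDistToMarginals Ω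
                  (fun p => marginal Dr (p.1 : Finset (Fin (m+1))) p.2.1 + z p) Ds ≤
                maxDistToMarginals Ω
                  (fun p => marginal Dr (p.1 : Finset (Fin (m+1))) p.2.1 + z p) D) →
            ∀ q : Finset (Fin (m+1)), q.Nonempty → q.card ≤ d →
              margL1 Ω Dr Ds q ≤
                2 * (l : ℝ) ^ d *
                  Real.sqrt (2 * (Real.log 2 * (1 + lam) + (d : ℝ) * Real.log (m * l))) * σ} ≥
      ENNReal.ofReal (1 - (2 : ℝ) ^ (-lam)) := by
  have hlΩ : ∀ j, (Ω j).card ≤ l := fun j => by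
    rw [hl]
    exact Finset.le_sup (f := fun j => (Ω j).card) (Finset.mem_univ j)
  have hl1 : 1 ≤ l := by
    refine le_trans ?_ (hlΩ (Fin.last m))
    rw [hΩ.2]
    exact Finset.card_pos.2 ⟨-1, by simp⟩
  have hk : (1 : ℝ) ≤ m * l := by exact_mod_cast Nat.mul_pos hm hl1
  set τ : ℝ := Real.sqrt (2 * (Real.log 2 * (1 + lam) + (d : ℝ) * Real.log (m * l))) * σ with hτdef
  have hτ : 0 ≤ τ := by positivity
  have : IsProbabilityMeasure (noiseMeasure m d Ω σ) := by
    unfold noiseMeasure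
    infer_instance
  have hbad : (noiseMeasure m d Ω σ).real {z | ∃ p, τ ≤ |z p|} ≤ (2 : ℝ) ^ (-lam) := by
    refine (measureReal_pi_exists_le_abs_gaussianReal _ hτ).trans ?_
    rw [Real.coe_toNNReal _ (sq_nonneg σ), hτdef, exp_neg_sq_sqrt_div d hk hσ hlam]
    have hcard : (Fintype.card (MargIdx m d Ω) : ℝ) ≤ ((m : ℝ) * l) ^ d := by
      rw [mul_pow]
      exact_mod_cast (card_margIdx_le Ω hl1 hlΩ).trans (Nat.mul_le_mul_right _ hQ)
    have hkd : (0 : ℝ) < ((m : ℝ) * l) ^ d := by positivity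
    refine (mul_le_mul_of_nonneg_right hcard (by positivity)).trans_eq ?_
    rw [neg_add, Real.rpow_add two_pos, Real.rpow_neg_one]
    field_simp
  have hgood : ENNReal.ofReal (1 - (2 : ℝ) ^ (-lam)) ≤
      noiseMeasure m d Ω σ {z | ∃ p, τ ≤ |z p|}ᶜ := by
    have h := measureReal_union_le (μ := noiseMeasure m d Ω σ)
      {z | ∃ p, τ ≤ |z p|} {z | ∃ p, τ ≤ |z p|}ᶜ
    rw [Set.union_compl_self, probReal_univ] at h
    rw [ENNReal.ofReal_le_iff_le_toReal (measure_ne_top _ _)]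
    change _ ≤ (noiseMeasure m d Ω σ).real _
    linarith
  refine hgood.trans (measure_mono fun z hz Ds _ hmin q hq hqd => ?_)
  have hz' : ∀ p, |z p| ≤ τ := by
    simpa using fun p => (not_le.1 (not_exists.1 hz p)).le
  rw [mul_assoc, ← hτdef]
  exact margL1_le_of_noise_le hl1 hlΩ hτ hz' (hmin Dr hDr) ⟨q, hq, hqd⟩
end
end
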